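/- Let X be a topological space. Then the ring C(X;ℂ) of continuous complex-valued functions on X is coherent if and only if the ring C(X;ℝ) of continuous real-valued functions on X is coherent. -/

import Mathlib

set_option synthInstance.maxHeartbeats 1000000
set_option maxHeartbeats 1000000

/-- A ring is coherent iff the kernel of every linear form on a finite free module is finitely
generated. -/
theorem Ideal.forall_fg_finitePresentation_iff (A : Type*) [CommRing A] :
    (∀ I : Ideal A, I.FG → Module.FinitePresentation A I) ↔
      ∀ (n : ℕ) (f : (Fin n → A) →ₗ[A] A), (LinearMap.ker f).FG := by
  constructor
  · intro h n f
    have hfg : (LinearMap.range f).FG := by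
      rw [LinearMap.range_eq_map]
      exact Submodule.FG.map f Module.Finite.fg_top
    have := h (LinearMap.range f) hfg
    rw [← LinearMap.ker_rangeRestrict]
    exact Module.FinitePresentation.fg_ker _ f.surjective_rangeRestrict
  · intro h I hI
    have : Module.Finite A I := Module.Finite.iff_fg.mpr hI
    obtain ⟨n, f, hf⟩ := Module.Finite.exists_fin' A I
    refine Module.finitePresentation_of_surjective f hf ?_
    have := h n ((Submodule.subtype I).comp f)
    rwa [LinearMap.ker_comp_of_ker_eq_bot _ (Submodule.ker_subtype I)] at this

section

variable {A : Type*} [CommRing A] {M : Type*} [AddCommGroup M] [Module A M] [Module.Finite A M]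

theorem LinearMap.fg_ker_of_forall_fg_ker_pi
    (h : ∀ (n : ℕ) (f : (Fin n → A) →ₗ[A] A), (LinearMap.ker f).FG)
    (f : M →ₗ[A] A) : (LinearMap.ker f).FG := by
  obtain ⟨n, p, hp⟩ := Module.Finite.exists_fin' A M
  have := (h n (f.comp p)).map p
  rwa [LinearMap.ker_comp, Submodule.map_comap_eq_of_surjective hp] at this

theorem LinearMap.fg_ker_inf_ker_of_forall_fg_ker_pi
    (h : ∀ (n : ℕ) (f : (Fin n → A) →ₗ[A] A), (LinearMap.ker f).FG)
    (f g : M →ₗ[A] A) :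
    (LinearMap.ker f ⊓ LinearMap.ker g).FG := by
  have : Module.Finite A (LinearMap.ker f) :=
    Module.Finite.iff_fg.mpr (LinearMap.fg_ker_of_forall_fg_ker_pi h f)
  have := (LinearMap.fg_ker_of_forall_fg_ker_pi h
    (g.comp (LinearMap.ker f).subtype)).map (LinearMap.ker f).subtype
  rwa [LinearMap.ker_comp, Submodule.map_comap_subtype] at this

end

section

variable {R S : Type*} [CommRing R] [CommRing S] [Algebra R S] [Module.Finite R S]

theorem LinearMap.forall_fg_ker_pi_of_retraction (re : S →ₗ[R] R) (hre : re 1 = 1)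
    (h : ∀ (n : ℕ) (f : (Fin n → S) →ₗ[S] S), (LinearMap.ker f).FG)
    (n : ℕ) (f : (Fin n → R) →ₗ[R] R) : (LinearMap.ker f).FG := by
  let F : (Fin n → S) →ₗ[S] S :=
    Fintype.linearCombination S fun j => algebraMap R S (f (Pi.single j 1))
  have hf (x : Fin n → R) : f x = ∑ j, x j * f (Pi.single j 1) := by
    conv_lhs => rw [LinearMap.pi_apply_eq_sum_univ f x]
    simp only [smul_eq_mul]
    refine Finset.sum_congr rfl fun j _ => ?_
    congr 2
    ext i
    simp [Pi.single_apply, eq_comm]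
  have hre_alg (r : R) : re (algebraMap R S r) = r := by
    rw [Algebra.algebraMap_eq_smul_one, map_smul, hre, smul_eq_mul, mul_one]
  have hF (s : Fin n → S) : re (F s) = f (re ∘ s) := by
    rw [hf]
    simp only [F, Fintype.linearCombination_apply, map_sum, smul_eq_mul, Function.comp_apply]
    refine Finset.sum_congr rfl fun j _ => ?_
    rw [mul_comm, ← Algebra.smul_def, map_smul, smul_eq_mul, mul_comm]
  have hFR (x : Fin n → R) : F (algebraMap R S ∘ x) = algebraMap R S (f x) := by
    rw [hf]
    simp [F, Fintype.linearCombination_apply]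
  have : Module.Finite S (LinearMap.ker F) := Module.Finite.iff_fg.mpr (h n F)
  have : Module.Finite R (LinearMap.ker F) := Module.Finite.trans S _
  have hK : ((LinearMap.ker F).restrictScalars R).FG := Module.Finite.iff_fg.mp this
  convert hK.map (re.compLeft (Fin n))
  ext x
  simp only [LinearMap.mem_ker, Submodule.mem_map, Submodule.restrictScalars_mem]
  constructor
  · intro hx
    refine ⟨algebraMap R S ∘ x, by rw [hFR, hx, map_zero], ?_⟩
    ext j
    simp [hre_alg]
  · rintro ⟨s, hs, rfl⟩
    change f (re ∘ s) = 0
    rw [← hF, hs, map_zero]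

theorem LinearMap.forall_fg_ker_pi_of_injective_prod (re im : S →ₗ[R] R)
    (hinj : ∀ s, re s = 0 → im s = 0 → s = 0)
    (h : ∀ (n : ℕ) (f : (Fin n → R) →ₗ[R] R), (LinearMap.ker f).FG)
    (n : ℕ) (f : (Fin n → S) →ₗ[S] S) : (LinearMap.ker f).FG := by
  have hK := LinearMap.fg_ker_inf_ker_of_forall_fg_ker_pi h
    (re.comp (f.restrictScalars R)) (im.comp (f.restrictScalars R))
  have hker : (LinearMap.ker f).restrictScalars R =
      LinearMap.ker (re.comp (f.restrictScalars R)) ⊓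
        LinearMap.ker (im.comp (f.restrictScalars R)) := by
    ext s
    simp only [Submodule.restrictScalars_mem, LinearMap.mem_ker, Submodule.mem_inf,
      LinearMap.comp_apply, LinearMap.restrictScalars_apply]
    exact ⟨fun hs => by simp [hs], fun hs => hinj _ hs.1 hs.2⟩
  exact Submodule.FG.of_restrictScalars R (hker ▸ hK)

end

/-- For a topological space `X`, the ring `C(X;ℂ)` of continuous complex-valued functions
is coherent (every finitely generated ideal is finitely presented) if and only if the ring
`C(X;ℝ)` of continuous real-valued functions is coherent. -/
theorem continuousMap_complex_coherent_iff_real_coherent (X : Type*) [TopologicalSpace X] :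
    (∀ I : Ideal C(X, ℂ), I.FG → Module.FinitePresentation C(X, ℂ) I) ↔
    (∀ I : Ideal C(X, ℝ), I.FG → Module.FinitePresentation C(X, ℝ) I) := by
  rw [Ideal.forall_fg_finitePresentation_iff, Ideal.forall_fg_finitePresentation_iff]
  let φ : C(X, ℝ) →+* C(X, ℂ) := Complex.ofRealHom.compLeftContinuous X Complex.continuous_ofReal
  let : Algebra C(X, ℝ) C(X, ℂ) := φ.toAlgebra
  have hsmul (r : C(X, ℝ)) (s : C(X, ℂ)) (x : X) : (φ r * s) x = (r x : ℂ) * s x := rfl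
  let re : letI := φ.toAlgebra.toModule; C(X, ℂ) →ₗ[C(X, ℝ)] C(X, ℝ) :=
    let := φ.toAlgebra.toModule
    { toFun := fun s => ⟨fun x => (s x).re, by fun_prop⟩
      map_add' := fun s t => by ext x; simp
      map_smul' := fun r s => by
        ext x
        change ((φ r * s) x).re = r x * (s x).re
        simp [hsmul] }
  let im : letI := φ.toAlgebra.toModule; C(X, ℂ) →ₗ[C(X, ℝ)] C(X, ℝ) :=
    let := φ.toAlgebra.toModule
    { toFun := fun s => ⟨fun x => (s x).im, by fun_prop⟩
      map_add' := fun s t => by ext x; simp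
      map_smul' := fun r s => by
        ext x
        change ((φ r * s) x).im = r x * (s x).im
        simp [hsmul] }
  have hfin : @Module.Finite C(X, ℝ) C(X, ℂ) _ _ φ.toAlgebra.toModule := by
    let := φ.toAlgebra.toModule
    classical
    refine ⟨⟨{1, ContinuousMap.const X Complex.I}, ?_⟩⟩
    rw [eq_top_iff]
    intro s _
    rw [Finset.coe_pair, Submodule.mem_span_pair]
    refine ⟨re s, im s, ?_⟩
    ext x
    change ((s x).re : ℂ) * 1 + ((s x).im : ℂ) * Complex.I = s x
    rw [mul_one, Complex.re_add_im]
  constructor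
  · refine LinearMap.forall_fg_ker_pi_of_retraction re ?_
    ext x
    rfl
  · refine LinearMap.forall_fg_ker_pi_of_injective_prod re im fun s hr hi => ?_
    ext x
    exact Complex.ext (DFunLike.congr_fun hr x) (DFunLike.congr_fun hi x)
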